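/- arXiv:math/9810071 — 3 statements merged into one kernel-verified Lean document; each statement's English description precedes it below -/
import Mathlib

section
/- For every prime p ≥ 5 there exist elements Q and R of ZMod p, each of which is a sum of three squares of units of ZMod p (Q = q₁²+q₂²+q₃² and R = r₁²+r₂²+r₃² with all qᵢ, rⱼ units), such that there is no unit k of ZMod p with R·k² = Q. -/
/-- The arithmetic core of Lemma 6: for every prime `p ≥ 5` there are elements
`Q` and `R` of `ZMod p`, each a sum of three squares of units, such that
`R·k² = Q` has no solution `k` coprime to `p`. -/
theorem stmt2 (p : ℕ) (hp : p.Prime) (hp5 : 5 ≤ p) :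
    ∃ Q R : ZMod p,
      (∃ q₁ q₂ q₃ : ZMod p, IsUnit q₁ ∧ IsUnit q₂ ∧ IsUnit q₃ ∧
        Q = q₁ ^ 2 + q₂ ^ 2 + q₃ ^ 2) ∧
      (∃ r₁ r₂ r₃ : ZMod p, IsUnit r₁ ∧ IsUnit r₂ ∧ IsUnit r₃ ∧
        R = r₁ ^ 2 + r₂ ^ 2 + r₃ ^ 2) ∧
      ¬ ∃ k : ZMod p, IsUnit k ∧ R * k ^ 2 = Q := by
  have := Fact.mk hp
  have isUnit_of_lt : ∀ m : ℕ, 0 < m → m < p → IsUnit (m : ZMod p) := fun m hm hmp =>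
    (ZMod.isUnit_iff_coprime m p).2
      (hp.coprime_iff_not_dvd.2 (Nat.not_dvd_of_pos_of_lt hm hmp)).symm
  have h2 : IsUnit (2 : ZMod p) := mod_cast isUnit_of_lt 2 (by omega) (by omega)
  have h3 : IsUnit (3 : ZMod p) := mod_cast isUnit_of_lt 3 (by omega) (by omega)
  by_contra hcon
  have three_mul_sq : ∀ a b c : ZMod p, IsUnit a → IsUnit b → IsUnit c →
      ∃ k : ZMod p, IsUnit k ∧ 3 * k ^ 2 = a ^ 2 + b ^ 2 + c ^ 2 := by
    intro a b c ha hb hc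
    by_contra hk
    exact hcon ⟨_, 3, ⟨a, b, c, ha, hb, hc, rfl⟩,
      ⟨1, 1, 1, isUnit_one, isUnit_one, isUnit_one, by norm_num⟩, hk⟩
  -- Since `9 = 2² + 2² + 1²`, the element `3` is itself a unit square.
  obtain ⟨t, ht, ht9⟩ := three_mul_sq 2 2 1 h2 h2 isUnit_one
  have ht3 : t ^ 2 = 3 := h3.mul_left_cancel (by rw [ht9]; norm_num)
  -- Adding `1² + 1²` repeatedly, every odd number is a unit square, including `p`.
  have odd_isSquare : ∀ n : ℕ, ∃ a : ZMod p, IsUnit a ∧ a ^ 2 = 2 * n + 1 := by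
    intro n
    induction n with
    | zero => exact ⟨1, isUnit_one, by simp⟩
    | succ n ih =>
      obtain ⟨a, ha, han⟩ := ih
      obtain ⟨k, hk, hka⟩ := three_mul_sq a 1 1 ha isUnit_one isUnit_one
      refine ⟨t * k, ht.mul hk, ?_⟩
      rw [mul_pow, ht3, hka, han]
      push_cast
      ring
  obtain ⟨n, hn⟩ := hp.odd_of_ne_two (by omega)
  obtain ⟨a, ha, han⟩ := odd_isSquare n
  have hp0 : (2 * n + 1 : ZMod p) = 0 := by
    have h : ((2 * n + 1 : ℕ) : ZMod p) = 0 := (ZMod.natCast_eq_zero_iff _ _).2 hn.dvd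
    exact_mod_cast h
  exact (ha.pow 2).ne_zero (han.trans hp0)
end

section
/- Let p ≥ 5 be a prime such that (p+1)/2 is a quadratic residue modulo p. Then there exists an element Q of ZMod p which is a sum of three squares of units of ZMod p, such that the congruence 2k² ≡ Q (mod p) has no solution k coprime to p. -/
/-- The iterative step (with `R = 2`) in the proof of Lemma 6: if `p ≥ 5` is a
prime such that `(p+1)/2` is a quadratic residue mod `p`, then there is a sum
of three unit squares `Q` in `ZMod p` such that `2k² ≡ Q (mod p)` has no
solution `k` coprime to `p`. -/
theorem stmt5 (p : ℕ) (hp : p.Prime) (hp5 : 5 ≤ p)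
    (hqr : ∃ n : ZMod p, n ^ 2 = (((p + 1) / 2 : ℕ) : ZMod p)) :
    ∃ Q : ZMod p,
      (∃ q₁ q₂ q₃ : ZMod p, IsUnit q₁ ∧ IsUnit q₂ ∧ IsUnit q₃ ∧
        Q = q₁ ^ 2 + q₂ ^ 2 + q₃ ^ 2) ∧
      ¬ ∃ k : ZMod p, IsUnit k ∧ 2 * k ^ 2 = Q := by
  have : Fact p.Prime := ⟨hp⟩
  obtain ⟨n, hn⟩ := hqr
  have hodd : 2 * ((p + 1) / 2) = p + 1 := by
    rcases hp.eq_two_or_odd with h | h <;> omega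
  have htwo : 2 * n ^ 2 = 1 := by
    rw [hn]
    have h := congrArg (Nat.cast : ℕ → ZMod p) hodd
    push_cast at h
    simpa using h
  have hn0 : n ≠ 0 := by
    rintro rfl
    simp at htwo
  have h20 : (2 : ZMod p) ≠ 0 := left_ne_zero_of_mul_eq_one htwo
  by_contra! hcon
  have hsq : ∀ m : ℕ, ∃ k : ZMod p, k ≠ 0 ∧ k ^ 2 = m + 1 := by
    intro m
    induction m with
    | zero => exact ⟨1, one_ne_zero, by simp⟩
    | succ m ih =>
      obtain ⟨k, hk0, hk⟩ := ih
      have hu : IsUnit (n * k) := (mul_ne_zero hn0 hk0).isUnit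
      obtain ⟨l, hl, hlk⟩ := hcon _ ⟨n * k, n * k, 1, hu, hu, isUnit_one, rfl⟩
      refine ⟨2 * n * l, mul_ne_zero (mul_ne_zero h20 hn0) hl.ne_zero, ?_⟩
      push_cast
      linear_combination (2 * l ^ 2 + k ^ 2) * htwo + hlk + hk
  obtain ⟨k, hk0, hk⟩ := hsq (p - 1)
  have hp0 : ((p - 1 : ℕ) : ZMod p) + 1 = 0 := by
    rw [← Nat.cast_add_one, Nat.sub_add_cancel hp.one_le, ZMod.natCast_self]
  exact hk0 (pow_eq_zero_iff two_ne_zero |>.mp (hk.trans hp0))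
end

section
/- Let p be an odd prime, k ≥ 1, and let ρ : ZMod p → U(3) be a group homomorphism into the unitary group of ℂ³ whose induced action on the unit sphere S⁵ ⊂ ℂ³ is free, i.e. for every g ≠ 0 in ZMod p and every unit vector v ∈ ℂ³ one has ρ(g)·v ≠ v. Then ρ extends to a free unitary action of ZMod p^k: there exists a group homomorphism ρ' : ZMod p^k → U(3) whose induced action on the unit sphere is free and such that ρ'(ι(x)) = ρ(x) for all x ∈ ZMod p, where ι : ZMod p → ZMod p^k is the injective group homomorphism sending x to p^(k−1)·x. -/
open Matrix

section UnitaryRoots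

open scoped Matrix.Norms.L2Operator

/-- Every unitary complex matrix has a unitary `m`-th root, for `m ≠ 0`. -/
theorem Matrix.unitaryGroup.exists_pow_eq {n : Type*} [Fintype n] [DecidableEq n]
    (U : Matrix.unitaryGroup n ℂ) {m : ℕ} (hm : m ≠ 0) :
    ∃ V : Matrix.unitaryGroup n ℂ, V ^ m = U := by
  set A : Matrix n n ℂ := (U : Matrix n n ℂ) with hA
  have hAu : A ∈ unitary (Matrix n n ℂ) := U.2
  have hnormal : IsStarNormal A :=
    ⟨(Unitary.star_mul_self_of_mem hAu).trans (Unitary.mul_star_self_of_mem hAu).symm⟩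
  have hcont (f : ℂ → ℂ) : ContinuousOn f (spectrum ℂ A) :=
    (Matrix.finite_spectrum A).continuousOn f
  let f : ℂ → ℂ := fun z ↦ z ^ ((m : ℂ)⁻¹)
  have hf (z : ℂ) : f z ^ m = z := Complex.cpow_nat_inv_pow z hm
  have hnorm (z : ℂ) (hz : z ∈ spectrum ℂ A) : ‖f z‖ = 1 := by
    have hz1 : ‖z‖ = 1 := by
      simpa using spectrum.subset_circle_of_unitary hAu hz
    refine (pow_eq_one_iff_of_nonneg (norm_nonneg _) hm).mp ?_
    rw [← norm_pow, hf, hz1]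
  have hunit : cfc f A ∈ unitary (Matrix n n ℂ) := by
    rw [cfc_unitary_iff f A hnormal (hcont f)]
    intro z hz
    simpa [hnorm z hz] using Complex.conj_mul' (f z)
  refine ⟨⟨cfc f A, hunit⟩, Subtype.ext ?_⟩
  change cfc f A ^ m = A
  rw [← cfc_pow f m A (hcont f), funext hf]
  exact cfc_id' ℂ A

end UnitaryRoots

/-- The homomorphism from `ℤ/n` sending the generator to an element with trivial `n`-th power. -/
theorem ZMod.exists_monoidHom_natCast_eq_pow {G : Type*} [Group G] (n : ℕ) (b : G)
    (hb : b ^ n = 1) :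
    ∃ φ : Multiplicative (ZMod n) →* G,
      ∀ i : ℕ, φ (Multiplicative.ofAdd (i : ZMod n)) = b ^ i := by
  refine ⟨AddMonoidHom.toMultiplicativeLeft (ZMod.lift n
    ⟨zmultiplesHom (Additive G) (Additive.ofMul b), ?_⟩), fun i ↦ ?_⟩
  · simp [← ofMul_pow, hb]
  · have h := ZMod.lift_coe n (⟨zmultiplesHom (Additive G) (Additive.ofMul b), by
      simp [← ofMul_pow, hb]⟩ : {f : ℤ →+ Additive G // f n = 0}) (i : ℤ)
    simp only [Int.cast_natCast] at h
    simp [h]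

/-- A vector fixed by a unitary matrix is fixed by its powers. -/
theorem Matrix.unitaryGroup.toEuclideanLin_pow_eq {n : Type*} [Fintype n] [DecidableEq n]
    (U : Matrix.unitaryGroup n ℂ) {v : EuclideanSpace ℂ n}
    (h : Matrix.toEuclideanLin (U : Matrix n n ℂ) v = v) (m : ℕ) :
    Matrix.toEuclideanLin ((U ^ m : Matrix.unitaryGroup n ℂ) : Matrix n n ℂ) v = v := by
  induction m with
  | zero => simp
  | succ m ih =>
    have hmul : Matrix.toEuclideanLin ((U ^ (m + 1) : Matrix.unitaryGroup n ℂ) : Matrix n n ℂ) v =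
        Matrix.toEuclideanLin ((U ^ m : Matrix.unitaryGroup n ℂ) : Matrix n n ℂ)
          (Matrix.toEuclideanLin (U : Matrix n n ℂ) v) := by
      simp [Matrix.toLpLin_apply, pow_succ]
    rw [hmul, h, ih]

/-- The extension claim in the proof of Proposition 9: every free linear
(unitary) action of `ℤ/p` on the unit sphere `S⁵ ⊂ ℂ³` extends to a free
linear action of `ℤ/p^k`, where `ℤ/p` is embedded in `ℤ/p^k` as the subgroup
`{p^(k-1)·x : x ∈ ℤ/p}`. -/
theorem stmt6 (p : ℕ) (hp : p.Prime) (hodd : Odd p) (k : ℕ) (hk : 1 ≤ k)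
    (ρ : Multiplicative (ZMod p) →* Matrix.unitaryGroup (Fin 3) ℂ)
    (hfree : ∀ g : Multiplicative (ZMod p), g ≠ 1 →
      ∀ v : EuclideanSpace ℂ (Fin 3), ‖v‖ = 1 →
        Matrix.toEuclideanLin (ρ g : Matrix (Fin 3) (Fin 3) ℂ) v ≠ v) :
    ∃ ρ' : Multiplicative (ZMod (p ^ k)) →* Matrix.unitaryGroup (Fin 3) ℂ,
      (∀ g : Multiplicative (ZMod (p ^ k)), g ≠ 1 →
        ∀ v : EuclideanSpace ℂ (Fin 3), ‖v‖ = 1 →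
          Matrix.toEuclideanLin (ρ' g : Matrix (Fin 3) (Fin 3) ℂ) v ≠ v) ∧
      ∀ x : ZMod p,
        ρ' (Multiplicative.ofAdd ((p ^ (k - 1) : ZMod (p ^ k)) * (x.val : ZMod (p ^ k)))) =
          ρ (Multiplicative.ofAdd x) := by
  have : NeZero p := ⟨hp.ne_zero⟩
  have hρ (i : ℕ) : ρ (Multiplicative.ofAdd (i : ZMod p)) = ρ (Multiplicative.ofAdd 1) ^ i := by
    rw [← map_pow, ← ofAdd_nsmul, nsmul_one]
  obtain ⟨B, hB⟩ := Matrix.unitaryGroup.exists_pow_eq (ρ (Multiplicative.ofAdd 1))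
    (pow_ne_zero (k - 1) hp.ne_zero)
  have hB1 : B ^ p ^ k = 1 := by
    rw [← Nat.sub_add_cancel hk, pow_succ, pow_mul, hB, ← hρ, ZMod.natCast_self, ofAdd_zero,
      map_one]
  obtain ⟨ρ', hρ'⟩ := ZMod.exists_monoidHom_natCast_eq_pow (p ^ k) B hB1
  refine ⟨ρ', fun g hg v hv hfix ↦ ?_, fun x ↦ ?_⟩
  · obtain ⟨a, ha⟩ := ZMod.natCast_zmod_surjective g.toAdd
    have hga : g = Multiplicative.ofAdd (a : ZMod (p ^ k)) := by rw [ha, ofAdd_toAdd]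
    have hdvd : ¬ p ^ k ∣ a := by
      rw [← ZMod.natCast_eq_zero_iff]
      intro h
      exact hg (by rw [hga, h, ofAdd_zero])
    have ha0 : a ≠ 0 := by
      rintro rfl
      exact hdvd (dvd_zero _)
    obtain ⟨j, m, hm, rfl⟩ := Nat.exists_eq_pow_mul_and_not_dvd ha0 p hp.ne_one
    have hj : j < k := by
      by_contra! hkj
      exact hdvd ((pow_dvd_pow p hkj).mul_right m)
    refine hfree (Multiplicative.ofAdd (m : ZMod p)) ?_ v hv ?_
    · rwa [Ne, ofAdd_eq_one, ZMod.natCast_eq_zero_iff]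
    · have hpow : ρ (Multiplicative.ofAdd (m : ZMod p)) = ρ' g ^ p ^ (k - 1 - j) := by
        rw [hρ, ← hB, hga, hρ', ← pow_mul, ← pow_mul, mul_right_comm, ← pow_add,
          Nat.add_sub_cancel' (Nat.le_sub_one_of_lt hj)]
      rw [hpow]
      exact Matrix.unitaryGroup.toEuclideanLin_pow_eq _ hfix _
  · have h := hρ' (p ^ (k - 1) * x.val)
    push_cast at h
    rw [h, pow_mul, hB, ← hρ, ZMod.natCast_zmod_val]
end
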